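/- Let p be a prime with p ≥ 5 and let g denote the multiplicative order of 2 in (ℤ/pℤ)^*. Let n = 2^c + 2^b + 2^a where c > b > a ≥ 0, and suppose that the residues of a, b, c modulo g form the multiset {g−2, g−2, g−1} (i.e. two of them are congruent to g−2 and one to g−1 modulo g). Then the cyclotomic polynomial Φ_{2p}(t) divides the descent set polynomial Q_n(t). -/

import Mathlib

/-- The descent set of a permutation of `Fin n`, as a subset of `[n-1] = {1,…,n-1}`
(1-based positions): `i` is a descent if `π(i) > π(i+1)`. -/
def descentSet (n : ℕ) (π : Equiv.Perm (Fin n)) : Finset ℕ :=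
  (Finset.Ico 1 n).filter fun i => ∀ h : i < n, π ⟨i, h⟩ < π ⟨i - 1, by omega⟩

/-- The descent set statistic `β_n(S)`: the number of permutations of `{1,…,n}`
with descent set `S`. -/
def beta (n : ℕ) (S : Finset ℕ) : ℕ :=
  (Finset.univ.filter fun π : Equiv.Perm (Fin n) => descentSet n π = S).card

/-- The descent set polynomial `Q_n(t) = ∑_{S ⊆ [n-1]} t^{β_n(S)}`. -/
noncomputable def Q (n : ℕ) : Polynomial ℤ :=
  ∑ S ∈ (Finset.Ico 1 n).powerset, Polynomial.X ^ beta n S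


open Finset in
lemma mem_descentSet {n : ℕ} {π : Equiv.Perm (Fin n)} {i : ℕ} :
    i ∈ descentSet n π ↔
      1 ≤ i ∧ ∃ h : i < n, π ⟨i, h⟩ < π ⟨i - 1, lt_of_le_of_lt (Nat.sub_le _ _) h⟩ := by
  simp only [descentSet, mem_filter, mem_Ico]
  constructor
  · rintro ⟨⟨h1, h2⟩, h3⟩
    exact ⟨h1, h2, h3 h2⟩
  · rintro ⟨h1, h2, h3⟩
    exact ⟨⟨h1, h2⟩, fun _ => h3⟩

lemma beta_empty (n : ℕ) : beta n ∅ = 1 := by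
  rw [beta, Finset.card_eq_one]
  refine ⟨1, ?_⟩
  ext π
  simp only [Finset.mem_filter, Finset.mem_univ, true_and, Finset.mem_singleton]
  constructor
  · intro h
    have hmono : StrictMono π := by
      cases n with
      | zero => exact fun i => i.elim0
      | succ n =>
        rw [Fin.strictMono_iff_lt_succ]
        intro i
        have hi : (i : ℕ) + 1 ∉ descentSet (n + 1) π := by simp [h]
        rw [mem_descentSet] at hi
        push Not at hi
        have := hi (by omega) (by omega)
        refine lt_of_le_of_ne this fun he => ?_
        have := π.injective he
        simp [Fin.ext_iff] at this
    ext i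
    have := congrArg (· i) (Subsingleton.elim
      (hmono.orderIsoOfSurjective π π.surjective) (OrderIso.refl (Fin n)))
    simpa [Fin.ext_iff] using this
  · rintro rfl
    ext i
    simp only [mem_descentSet, Equiv.Perm.coe_one, id_eq, Fin.mk_lt_mk, Finset.notMem_empty,
      iff_false]
    rintro ⟨h1, h2, h3⟩
    omega

/-- The permutation whose first `k` values form the set `s`, arranged in the pattern `σ`, and whose
other values are arranged in the pattern `τ`. -/
noncomputable def shufflePerm {k m : ℕ}
    (x : {s : Finset (Fin (k + m)) // s.card = k} × Equiv.Perm (Fin k) × Equiv.Perm (Fin m)) :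
    Equiv.Perm (Fin (k + m)) :=
  finSumFinEquiv.symm.trans ((Equiv.sumCongr x.2.1 x.2.2).trans
    (finSumEquivOfFinset x.1.2 (by rw [Finset.card_compl, x.1.2, Fintype.card_fin]; omega)))

section shufflePerm

variable {k m : ℕ}
  (x : {s : Finset (Fin (k + m)) // s.card = k} × Equiv.Perm (Fin k) × Equiv.Perm (Fin m))

lemma shufflePerm_castAdd (i : Fin k) :
    shufflePerm x (Fin.castAdd m i) = x.1.1.orderEmbOfFin x.1.2 (x.2.1 i) := by
  simp [shufflePerm]

lemma shufflePerm_natAdd (i : Fin m) :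
    shufflePerm x (Fin.natAdd k i) = x.1.1ᶜ.orderEmbOfFin
      (by rw [Finset.card_compl, x.1.2, Fintype.card_fin]; omega) (x.2.2 i) := by
  simp [shufflePerm]

lemma mem_iff_exists_shufflePerm (v : Fin (k + m)) :
    v ∈ x.1.1 ↔ ∃ i, shufflePerm x (Fin.castAdd m i) = v := by
  have h := congrArg (v ∈ ·) (Finset.range_orderEmbOfFin x.1.1 x.1.2)
  simp only [Finset.mem_coe, Set.mem_range, eq_iff_iff] at h
  rw [← h]
  simp only [shufflePerm_castAdd]
  constructor
  · rintro ⟨i, hi⟩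
    exact ⟨x.2.1.symm i, by simpa using hi⟩
  · rintro ⟨i, hi⟩
    exact ⟨x.2.1 i, hi⟩

lemma shufflePerm_injective : Function.Injective (shufflePerm (k := k) (m := m)) := by
  intro x y h
  have hs : x.1 = y.1 := by
    ext v
    rw [mem_iff_exists_shufflePerm, mem_iff_exists_shufflePerm, h]
  obtain ⟨s, σ, τ⟩ := x
  obtain ⟨s', σ', τ'⟩ := y
  obtain rfl : s = s' := hs
  have hσ : σ = σ' := by
    ext i : 1
    have := congrArg (fun π => π (Fin.castAdd m i)) h
    simpa only [shufflePerm_castAdd, EmbeddingLike.apply_eq_iff_eq] using this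
  have hτ : τ = τ' := by
    ext i : 1
    have := congrArg (fun π => π (Fin.natAdd k i)) h
    simpa only [shufflePerm_natAdd, EmbeddingLike.apply_eq_iff_eq] using this
  rw [hσ, hτ]

lemma shufflePerm_bijective : Function.Bijective (shufflePerm (k := k) (m := m)) := by
  rw [Fintype.bijective_iff_injective_and_card]
  refine ⟨shufflePerm_injective, ?_⟩
  simp only [Fintype.card_prod, Fintype.card_perm, Fintype.card_fin, Fintype.card_finset_len]
  rw [← mul_assoc, ← Nat.add_choose_mul_factorial_mul_factorial k m, Nat.choose_symm_add]

lemma mem_descentSet_shufflePerm_of_lt {j : ℕ} (hj : j < k) :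
    j ∈ descentSet (k + m) (shufflePerm x) ↔ j ∈ descentSet k x.2.1 := by
  have h1 := shufflePerm_castAdd x ⟨j, hj⟩
  have h2 := shufflePerm_castAdd x ⟨j - 1, by omega⟩
  simp only [Fin.castAdd_mk] at h1 h2
  simp only [mem_descentSet, h1, h2, OrderEmbedding.lt_iff_lt]
  simp [hj, show j < k + m by omega]

lemma mem_descentSet_shufflePerm_of_gt {j : ℕ} (hj : 0 < j) :
    k + j ∈ descentSet (k + m) (shufflePerm x) ↔ j ∈ descentSet m x.2.2 := by
  by_cases hm : j < m
  · have h1 := shufflePerm_natAdd x ⟨j, hm⟩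
    have h2 := shufflePerm_natAdd x ⟨j - 1, by omega⟩
    simp only [Fin.natAdd_mk, ← Nat.add_sub_assoc (show 1 ≤ j from hj)] at h1 h2
    simp only [mem_descentSet, h1, h2, OrderEmbedding.lt_iff_lt]
    simp [hm, show 1 ≤ j from hj, show 1 ≤ k + j by omega]
  · simp [mem_descentSet, hm]

end shufflePerm

open scoped symmDiff

lemma mem_image_sub {S : Finset ℕ} {k i : ℕ} :
    i ∈ {j ∈ S | k < j}.image (· - k) ↔ 0 < i ∧ k + i ∈ S := by
  simp only [Finset.mem_image, Finset.mem_filter]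
  constructor
  · rintro ⟨j, ⟨hj, hkj⟩, rfl⟩
    exact ⟨by omega, by rwa [Nat.add_sub_cancel' hkj.le]⟩
  · rintro ⟨hi, hS⟩
    exact ⟨k + i, ⟨hS, by omega⟩, by omega⟩

/-- Toggling the position `k` in a descent set: the permutations whose descent set agrees with `S`
away from `k` are shuffles of two independent words of lengths `k` and `m`. -/
lemma beta_add_beta_symmDiff (k m : ℕ) (S : Finset ℕ) :
    beta (k + m) S + beta (k + m) (S ∆ {k}) =
      (k + m).choose k *
        (beta k {i ∈ S | i < k} * beta m ({i ∈ S | k < i}.image (· - k))) := by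
  classical
  set L : Finset ℕ := {i ∈ S | i < k} with hL
  set R : Finset ℕ := {i ∈ S | k < i}.image (· - k) with hR
  have memR (i : ℕ) : i ∈ R ↔ 0 < i ∧ k + i ∈ S := mem_image_sub
  have key (x : {s : Finset (Fin (k + m)) // s.card = k} × Equiv.Perm (Fin k) ×
      Equiv.Perm (Fin m)) :
      (descentSet (k + m) (shufflePerm x) = S ∨ descentSet (k + m) (shufflePerm x) = S ∆ {k}) ↔
        descentSet k x.2.1 = L ∧ descentSet m x.2.2 = R := by
    have h1 : (descentSet (k + m) (shufflePerm x) = S ∨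
        descentSet (k + m) (shufflePerm x) = S ∆ {k}) ↔
        ∀ j, j ≠ k → (j ∈ descentSet (k + m) (shufflePerm x) ↔ j ∈ S) := by
      constructor
      · rintro (h | h) j hj <;> simp [h, Finset.mem_symmDiff, hj]
      · intro h
        by_cases hk : k ∈ descentSet (k + m) (shufflePerm x) ↔ k ∈ S
        · left
          ext j
          by_cases hj : j = k
          · rwa [hj]
          · exact h j hj
        · right
          ext j
          by_cases hj : j = k
          · subst hj
            simp only [Finset.mem_symmDiff, Finset.mem_singleton]
            tauto
          · simp [h j hj, Finset.mem_symmDiff, hj]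
    rw [h1, Finset.ext_iff, Finset.ext_iff]
    constructor
    · intro h
      refine ⟨fun j => ?_, fun j => ?_⟩
      · by_cases hj : j < k
        · rw [← mem_descentSet_shufflePerm_of_lt x hj, h j hj.ne]
          simp [hL, hj]
        · simp [hL, hj, mem_descentSet]
      · by_cases hj : 0 < j
        · rw [← mem_descentSet_shufflePerm_of_gt x hj, h _ (by omega), memR]
          simp [hj]
        · simp [memR, mem_descentSet, show j = 0 by omega]
    · rintro ⟨hl, hr⟩ j hj
      rcases lt_or_gt_of_ne hj with hj | hj
      · rw [mem_descentSet_shufflePerm_of_lt x hj, hl]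
        simp [hL, hj]
      · obtain ⟨i, rfl⟩ := Nat.exists_eq_add_of_lt hj
        rw [add_assoc, mem_descentSet_shufflePerm_of_gt x (by omega), hr, memR]
        simp
  have hne : S ≠ S ∆ {k} := fun h => by
    have := congrArg (k ∈ ·) h
    simp [Finset.mem_symmDiff] at this
  simp only [beta]
  rw [← Finset.card_union_of_disjoint
      (Finset.disjoint_filter.2 fun π _ h h' => hne (h.symm.trans h')),
    ← Finset.filter_or, ← Fintype.card_subtype,
    ← Fintype.card_congr ((Equiv.ofBijective _ shufflePerm_bijective).subtypeEquiv
      fun x => (key x).symm), Fintype.card_subtype]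
  have : (Finset.univ.filter fun x : {s : Finset (Fin (k + m)) // s.card = k} ×
      Equiv.Perm (Fin k) × Equiv.Perm (Fin m) =>
        descentSet k x.2.1 = L ∧ descentSet m x.2.2 = R) =
      Finset.univ ×ˢ ({σ | descentSet k σ = L} : Finset _) ×ˢ
        ({τ | descentSet m τ = R} : Finset _) := by
    ext x
    simp
  rw [this, Finset.card_product, Finset.card_product, Finset.card_univ, Fintype.card_finset_len,
    Fintype.card_fin]

lemma filter_lt_subset_Ico {S : Finset ℕ} {k m : ℕ} (hS : S ⊆ Finset.Ico 1 (k + m)) :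
    {i ∈ S | i < k} ⊆ Finset.Ico 1 k := by
  intro i hi
  rw [Finset.mem_filter] at hi
  have := Finset.mem_Ico.1 (hS hi.1)
  exact Finset.mem_Ico.2 ⟨this.1, hi.2⟩

lemma image_sub_subset_Ico {S : Finset ℕ} {k m : ℕ} (hS : S ⊆ Finset.Ico 1 (k + m)) :
    {i ∈ S | k < i}.image (· - k) ⊆ Finset.Ico 1 m := by
  intro i hi
  rw [mem_image_sub] at hi
  have := Finset.mem_Ico.1 (hS hi.2)
  exact Finset.mem_Ico.2 ⟨hi.1, by omega⟩

lemma beta_symmDiff_of_choose_eq_zero {q n i : ℕ} (hi : i ≤ n) (S : Finset ℕ)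
    (h : (n.choose i : ZMod q) = 0) : (beta n (S ∆ {i}) : ZMod q) = -beta n S := by
  obtain ⟨m, rfl⟩ := Nat.exists_eq_add_of_le hi
  have := congrArg (Nat.cast : ℕ → ZMod q) (beta_add_beta_symmDiff i m S)
  push_cast [h] at this
  rw [zero_mul, add_comm] at this
  exact eq_neg_of_add_eq_zero_left this

lemma insert_eq_symmDiff {S : Finset ℕ} {i : ℕ} (hi : i ∉ S) : insert i S = S ∆ {i} := by
  ext j
  simp only [Finset.mem_insert, Finset.mem_symmDiff, Finset.mem_singleton]
  constructor
  · rintro (rfl | h)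
    · exact Or.inr ⟨rfl, hi⟩
    · exact Or.inl ⟨h, fun hj => hi (hj ▸ h)⟩
  · tauto

open Polynomial in
lemma one_add_X_pow_two_pow (u : ℕ) : (1 + X : (ZMod 2)[X]) ^ 2 ^ u = 1 + X ^ 2 ^ u := by
  rw [add_pow_char_pow, one_pow]

lemma choose_two_pow (u i : ℕ) : ((2 ^ u).choose i : ZMod 2) =
    (if i = 0 then 1 else 0) + (if i = 2 ^ u then 1 else 0) := by
  rw [← Polynomial.coeff_one_add_X_pow, one_add_X_pow_two_pow]
  simp [Polynomial.coeff_one, Polynomial.coeff_X_pow]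

lemma choose_two_pow_add (u v i : ℕ) : ((2 ^ u + 2 ^ v).choose i : ZMod 2) =
    (if i = 0 then 1 else 0) + (if i = 2 ^ u then 1 else 0) + (if i = 2 ^ v then 1 else 0) +
      (if i = 2 ^ u + 2 ^ v then 1 else 0) := by
  rw [← Polynomial.coeff_one_add_X_pow, pow_add, one_add_X_pow_two_pow, one_add_X_pow_two_pow]
  simp only [add_mul, mul_add, one_mul, mul_one, ← pow_add]
  simp only [Polynomial.coeff_add, Polynomial.coeff_one, Polynomial.coeff_X_pow]
  ring

lemma choose_two_pow_add_add (u v w i : ℕ) : ((2 ^ u + (2 ^ v + 2 ^ w)).choose i : ZMod 2) =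
    (if i = 0 then 1 else 0) + (if i = 2 ^ u then 1 else 0) + (if i = 2 ^ v then 1 else 0) +
      (if i = 2 ^ w then 1 else 0) + (if i = 2 ^ u + 2 ^ v then 1 else 0) +
      (if i = 2 ^ u + 2 ^ w then 1 else 0) + (if i = 2 ^ v + 2 ^ w then 1 else 0) +
      (if i = 2 ^ u + (2 ^ v + 2 ^ w) then 1 else 0) := by
  rw [← Polynomial.coeff_one_add_X_pow, pow_add, pow_add, one_add_X_pow_two_pow,
    one_add_X_pow_two_pow, one_add_X_pow_two_pow]
  simp only [add_mul, mul_add, one_mul, mul_one, ← pow_add]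
  simp only [Polynomial.coeff_add, Polynomial.coeff_one, Polynomial.coeff_X_pow]
  ring

lemma beta_two_pow (u : ℕ) {S : Finset ℕ} (hS : S ⊆ Finset.Ico 1 (2 ^ u)) :
    (beta (2 ^ u) S : ZMod 2) = 1 := by
  induction S using Finset.induction_on with
  | empty => simp [beta_empty]
  | insert i S hi ih =>
    rw [Finset.insert_subset_iff, Finset.mem_Ico] at hS
    rw [insert_eq_symmDiff hi, beta_symmDiff_of_choose_eq_zero hS.1.2.le, ih hS.2, CharTwo.neg_eq]
    rw [choose_two_pow, if_neg (by omega), if_neg (by omega), add_zero]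

lemma beta_two_pow_add {u v : ℕ} (huv : u ≠ v) {S : Finset ℕ}
    (hS : S ⊆ Finset.Ico 1 (2 ^ u + 2 ^ v)) :
    (beta (2 ^ u + 2 ^ v) S : ZMod 2) =
      1 + (if 2 ^ u ∈ S then 1 else 0) + (if 2 ^ v ∈ S then 1 else 0) := by
  have hne : 2 ^ u ≠ 2 ^ v := fun h => huv (Nat.pow_right_injective le_rfl h)
  have hu := Nat.two_pow_pos u
  have hv := Nat.two_pow_pos v
  have step {k l : ℕ} (hkl : 2 ^ k + 2 ^ l = 2 ^ u + 2 ^ v) (hk : 2 ^ k = 2 ^ u ∨ 2 ^ k = 2 ^ v)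
      {S : Finset ℕ} (hS : S ⊆ Finset.Ico 1 (2 ^ u + 2 ^ v)) :
      (beta (2 ^ u + 2 ^ v) (S ∆ {2 ^ k}) : ZMod 2) = beta (2 ^ u + 2 ^ v) S + 1 := by
    have := congrArg (Nat.cast : ℕ → ZMod 2) (beta_add_beta_symmDiff (2 ^ k) (2 ^ l) S)
    rw [hkl] at this
    push_cast at this
    rw [beta_two_pow _ (filter_lt_subset_Ico (m := 2 ^ l) (by rwa [hkl])),
      beta_two_pow _ (image_sub_subset_Ico (by rwa [hkl])), choose_two_pow_add,
      mul_one, mul_one] at this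
    have h1 : ((if 2 ^ k = 0 then 1 else 0) + (if 2 ^ k = 2 ^ u then 1 else 0) +
        (if 2 ^ k = 2 ^ v then 1 else 0) +
          (if 2 ^ k = 2 ^ u + 2 ^ v then 1 else 0) : ZMod 2) = 1 := by
      rcases hk with hk | hk <;> rw [hk] <;> simp [hne, hne.symm]
    rw [h1] at this
    rw [← this, CharTwo.add_cancel_left]
  induction S using Finset.induction_on with
  | empty => simp [beta_empty]
  | insert i S hi ih =>
    rw [Finset.insert_subset_iff, Finset.mem_Ico] at hS
    rw [insert_eq_symmDiff hi]
    by_cases h1 : i = 2 ^ u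
    · subst h1
      rw [step rfl (Or.inl rfl) hS.2, ih hS.2]
      simp only [Finset.mem_symmDiff, Finset.mem_singleton, hi, hne.symm]
      simp
      ring
    by_cases h2 : i = 2 ^ v
    · subst h2
      rw [step (add_comm _ _) (Or.inr rfl) hS.2, ih hS.2]
      simp only [Finset.mem_symmDiff, Finset.mem_singleton, hi, hne]
      simp
    rw [beta_symmDiff_of_choose_eq_zero hS.1.2.le, ih hS.2, CharTwo.neg_eq]
    · simp [Finset.mem_symmDiff, Ne.symm h1, Ne.symm h2]
    · rw [choose_two_pow_add, if_neg (by omega), if_neg h1, if_neg h2, if_neg (by omega)]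
      simp

lemma beta_symmDiff_two_pow {u v w : ℕ} (hvw : v ≠ w) {S : Finset ℕ}
    (hS : S ⊆ Finset.Ico 1 (2 ^ u + (2 ^ v + 2 ^ w)))
    (hodd : ((2 ^ u + (2 ^ v + 2 ^ w)).choose (2 ^ u) : ZMod 2) = 1) :
    (beta (2 ^ u + (2 ^ v + 2 ^ w)) (S ∆ {2 ^ u}) : ZMod 2) =
      beta (2 ^ u + (2 ^ v + 2 ^ w)) S +
        (1 + (if 2 ^ u + 2 ^ v ∈ S then 1 else 0) + (if 2 ^ u + 2 ^ w ∈ S then 1 else 0)) := by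
  have := congrArg (Nat.cast : ℕ → ZMod 2) (beta_add_beta_symmDiff (2 ^ u) (2 ^ v + 2 ^ w) S)
  push_cast at this
  rw [beta_two_pow _ (filter_lt_subset_Ico hS), beta_two_pow_add hvw (image_sub_subset_Ico hS),
    hodd, one_mul, one_mul] at this
  simp only [mem_image_sub, Nat.two_pow_pos, true_and] at this
  rw [← this, CharTwo.add_cancel_left]

lemma symmDiff_singleton_subset {S T : Finset ℕ} {i : ℕ} (hS : S ⊆ T) (hi : i ∈ T) :
    S ∆ {i} ⊆ T := by
  intro j hj
  rcases Finset.mem_symmDiff.1 hj with h | h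
  · exact hS h.1
  · rwa [Finset.mem_singleton.1 h.1]

/-- Toggling the positions `2^a`, `2^b`, `2^c` changes the parity of the descent set statistic
of `2^a + 2^b + 2^c`. -/
lemma beta_symmDiff_two_pows {a b c : ℕ} (hab : a < b) (hbc : b < c) {S : Finset ℕ}
    (hS : S ⊆ Finset.Ico 1 (2 ^ c + 2 ^ b + 2 ^ a)) :
    (beta (2 ^ c + 2 ^ b + 2 ^ a) (S ∆ {2 ^ a} ∆ {2 ^ b} ∆ {2 ^ c}) : ZMod 2) =
      beta (2 ^ c + 2 ^ b + 2 ^ a) S + 1 := by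
  have ha := Nat.two_pow_pos a
  have hb : 2 ^ a * 2 ≤ 2 ^ b := by
    rw [← pow_succ]; exact Nat.pow_le_pow_right two_pos hab
  have hc : 2 ^ b * 2 ≤ 2 ^ c := by
    rw [← pow_succ]; exact Nat.pow_le_pow_right two_pos hbc
  have ea : 2 ^ c + 2 ^ b + 2 ^ a = 2 ^ a + (2 ^ b + 2 ^ c) := by ring
  have eb : 2 ^ c + 2 ^ b + 2 ^ a = 2 ^ b + (2 ^ a + 2 ^ c) := by ring
  have ec : 2 ^ c + 2 ^ b + 2 ^ a = 2 ^ c + (2 ^ a + 2 ^ b) := by ring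
  have hA := beta_symmDiff_two_pow (u := a) (hbc.ne) (ea ▸ hS) (by
    rw [choose_two_pow_add_add]
    simp (disch := omega) only [if_neg]
    simp)
  have hSa := symmDiff_singleton_subset hS
    (Finset.mem_Ico.2 (by omega) : 2 ^ a ∈ Finset.Ico 1 (2 ^ c + 2 ^ b + 2 ^ a))
  have hB := beta_symmDiff_two_pow (u := b) ((hab.trans hbc).ne) (eb ▸ hSa) (by
    rw [choose_two_pow_add_add]
    simp (disch := omega) only [if_neg]
    simp)
  have hSb := symmDiff_singleton_subset hSa
    (Finset.mem_Ico.2 (by omega) : 2 ^ b ∈ Finset.Ico 1 (2 ^ c + 2 ^ b + 2 ^ a))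
  have hC := beta_symmDiff_two_pow (u := c) (hab.ne) (ec ▸ hSb) (by
    rw [choose_two_pow_add_add]
    simp (disch := omega) only [if_neg]
    simp)
  rw [← ea] at hA
  rw [← eb] at hB
  rw [← ec] at hC
  have h1 : 2 ^ b + 2 ^ a ∈ S ∆ {2 ^ a} ↔ 2 ^ a + 2 ^ b ∈ S := by
    rw [add_comm]
    simp [Finset.mem_symmDiff]
  have h2 : 2 ^ b + 2 ^ c ∈ S ∆ {2 ^ a} ↔ 2 ^ b + 2 ^ c ∈ S := by
    simp [Finset.mem_symmDiff, show 2 ^ b + 2 ^ c ≠ 2 ^ a by omega]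
  have h3 : 2 ^ c + 2 ^ a ∈ S ∆ {2 ^ a} ∆ {2 ^ b} ↔ 2 ^ a + 2 ^ c ∈ S := by
    rw [add_comm]
    simp [Finset.mem_symmDiff, show 2 ^ a + 2 ^ c ≠ 2 ^ b by omega]
  have h4 : 2 ^ c + 2 ^ b ∈ S ∆ {2 ^ a} ∆ {2 ^ b} ↔ 2 ^ b + 2 ^ c ∈ S := by
    rw [add_comm]
    simp [Finset.mem_symmDiff, show 2 ^ b + 2 ^ c ≠ 2 ^ a by omega]
  rw [hC, hB, hA]
  simp only [h1, h2, h3, h4]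
  have two : (2 : ZMod 2) = 0 := rfl
  linear_combination ((1 : ZMod 2) + (if 2 ^ a + 2 ^ b ∈ S then 1 else 0) +
    (if 2 ^ a + 2 ^ c ∈ S then 1 else 0) + (if 2 ^ b + 2 ^ c ∈ S then 1 else 0)) * two

lemma choose_eq_zero_of_mod_eq_one {p n i : ℕ} (hp : p.Prime) (hn : n % p = 1)
    (hi : 1 < i % p) : (n.choose i : ZMod p) = 0 := by
  have : Fact p.Prime := ⟨hp⟩
  have := (ZMod.natCast_eq_natCast_iff _ _ _).2
    (Choose.choose_modEq_choose_mod_mul_choose_div_nat (p := p) (n := n) (k := i))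
  rw [this, hn, Nat.choose_eq_zero_of_lt hi]
  simp

/-- If taking the symmetric difference with a fixed set `U` shifts the descent set statistic by
`p` modulo `2 * p`, then it is a sign-reversing involution on the terms of `Q_n` at a primitive
`2p`-th root of unity. -/
lemma cyclotomic_two_mul_dvd_Q {p n : ℕ} (hp : 0 < p) (U : Finset ℕ)
    (hsub : ∀ S ⊆ Finset.Ico 1 n, S ∆ U ⊆ Finset.Ico 1 n)
    (hshift : ∀ S ⊆ Finset.Ico 1 n, beta n (S ∆ U) ≡ beta n S + p [MOD 2 * p]) :
    Polynomial.cyclotomic (2 * p) ℤ ∣ Q n := by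
  obtain ⟨ω, hω⟩ : ∃ ω : ℂ, IsPrimitiveRoot ω (2 * p) :=
    ⟨_, Complex.isPrimitiveRoot_exp (2 * p) (by omega)⟩
  have hωp : ω ^ p = -1 := (hω.pow (by omega) (mul_comm 2 p)).eq_neg_one_of_two_right
  have hpair {S : Finset ℕ} (hS : S ⊆ Finset.Ico 1 n) :
      ω ^ beta n S + ω ^ beta n (S ∆ U) = 0 := by
    rw [pow_eq_pow_of_modEq (hshift S hS) hω.pow_eq_one, pow_add, hωp, mul_neg_one,
      add_neg_cancel]
  rw [Polynomial.cyclotomic_eq_minpoly hω (by omega)]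
  refine minpoly.isIntegrallyClosed_dvd (hω.isIntegral (by omega)) ?_
  rw [Q, map_sum]
  simp only [map_pow, Polynomial.aeval_X]
  refine Finset.sum_involution (fun S _ => S ∆ U) ?_ ?_ ?_ ?_
  · intro S hS
    exact hpair (Finset.mem_powerset.1 hS)
  · intro S hS h0 he
    have := hpair (Finset.mem_powerset.1 hS)
    rw [he, ← two_mul] at this
    exact h0 ((mul_eq_zero.1 this).resolve_left two_ne_zero)
  · intro S hS
    exact Finset.mem_powerset.2 (hsub S (Finset.mem_powerset.1 hS))
  · intro S _
    exact symmDiff_symmDiff_cancel_right U S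

/-- Let `p ≥ 5` be prime with `g` the multiplicative order of `2` modulo `p`,
and let `n = 2^c + 2^b + 2^a` with `c > b > a ≥ 0`. If the residues of
`a, b, c` modulo `g` form the multiset `{g-2, g-2, g-1}`, then `Φ_{2p}`
divides `Q_n(t)`. -/
theorem cyclotomic_two_p_dvd_three_digits_two (p a b c g : ℕ) (hp : p.Prime)
    (hp5 : 5 ≤ p) (hg : g = orderOf (2 : ZMod p))
    (hab : a < b) (hbc : b < c)
    (hcong : ({a % g, b % g, c % g} : Multiset ℕ) = {(g - 2) % g, (g - 2) % g, (g - 1) % g}) :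
    Polynomial.cyclotomic (2 * p) ℤ ∣ Q (2 ^ c + 2 ^ b + 2 ^ a) := by
  have : Fact p.Prime := ⟨hp⟩
  have h2 : (2 : ZMod p) ≠ 0 := by
    have := (ZMod.natCast_eq_zero_iff 2 p).not.2 fun h =>
      absurd (Nat.le_of_dvd two_pos h) (by omega)
    exact_mod_cast this
  have hgpow : (2 : ZMod p) ^ g = 1 := hg ▸ pow_orderOf_eq_one _
  have hg0 : 0 < g := by
    rw [hg, orderOf_pos_iff, isOfFinOrder_iff_pow_eq_one]
    exact ⟨p - 1, by omega, ZMod.pow_card_sub_one_eq_one h2⟩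
  have hg3 : 3 ≤ g := by
    have h1 : ((2 ^ g : ℕ) : ZMod p) = (1 : ℕ) := by exact_mod_cast hgpow
    rw [ZMod.natCast_eq_natCast_iff', Nat.mod_eq_of_lt (show 1 < p by omega)] at h1
    by_contra hlt
    have : g = 1 ∨ g = 2 := by omega
    rcases this with rfl | rfl
    · rw [Nat.mod_eq_of_lt (by omega)] at h1
      omega
    · rw [Nat.mod_eq_of_lt (by omega)] at h1
      omega
  rw [Nat.mod_eq_of_lt (show g - 2 < g by omega), Nat.mod_eq_of_lt (show g - 1 < g by omega)]
    at hcong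
  have hne {e : ℕ} (he : e ∈ ({a % g, b % g, c % g} : Multiset ℕ)) : e ≠ 0 := by
    rw [hcong] at he
    simp only [Multiset.insert_eq_cons, Multiset.mem_cons, Multiset.mem_singleton] at he
    omega
  have hpow {e : ℕ} (he : e % g ≠ 0) : 1 < 2 ^ e % p := by
    have h0 : 2 ^ e % p ≠ 0 := by
      intro h
      have := (ZMod.natCast_eq_zero_iff (2 ^ e) p).2 (Nat.dvd_of_mod_eq_zero h)
      push_cast at this
      exact pow_ne_zero e h2 this
    have h1 : 2 ^ e % p ≠ 1 := by
      intro h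
      have : ((2 ^ e : ℕ) : ZMod p) = (1 : ℕ) := by
        rw [ZMod.natCast_eq_natCast_iff', h, Nat.mod_eq_of_lt (show 1 < p by omega)]
      push_cast at this
      exact he (Nat.mod_eq_zero_of_dvd (hg ▸ orderOf_dvd_of_pow_eq_one this))
    omega
  have ha0 : a % g ≠ 0 := hne (by simp)
  have hb0 : b % g ≠ 0 := hne (by simp)
  have hc0 : c % g ≠ 0 := hne (by simp)
  have hn1 : (2 ^ c + 2 ^ b + 2 ^ a) % p = 1 := by
    have h : ((2 ^ c + 2 ^ b + 2 ^ a : ℕ) : ZMod p) = (1 : ℕ) := by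
      have hsum := congrArg (fun s => (s.map fun e => (2 : ZMod p) ^ e).sum) hcong
      simp only [Multiset.insert_eq_cons, Multiset.map_cons, Multiset.map_singleton,
        Multiset.sum_cons, Multiset.sum_singleton] at hsum
      have hm (e : ℕ) : (2 : ZMod p) ^ (e % g) = 2 ^ e := hg ▸ pow_mod_orderOf 2 e
      rw [hm, hm, hm] at hsum
      obtain ⟨r, rfl⟩ := Nat.exists_eq_add_of_le' (show 2 ≤ g by omega)
      rw [show r + 2 - 2 = r by omega, show r + 2 - 1 = r + 1 by omega] at hsum
      push_cast
      linear_combination hsum + hgpow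
    rwa [ZMod.natCast_eq_natCast_iff', Nat.mod_eq_of_lt (show 1 < p by omega)] at h
  set n := 2 ^ c + 2 ^ b + 2 ^ a with hn
  have ha : 2 ≤ 2 ^ a := by
    calc 2 = 2 ^ 1 := rfl
      _ ≤ 2 ^ a := Nat.pow_le_pow_right two_pos (Nat.pos_of_ne_zero (by rintro rfl; simp at ha0))
  have hb : 2 ^ a < 2 ^ b := Nat.pow_lt_pow_right one_lt_two hab
  have hc : 2 ^ b < 2 ^ c := Nat.pow_lt_pow_right one_lt_two hbc
  have hdvd {e : ℕ} (he : 2 ≤ 2 ^ e) : 2 ∣ 2 ^ e :=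
    dvd_pow_self 2 (by rintro rfl; simp at he)
  have hn2 : n % 2 = 0 := by
    have := hdvd ha
    have := hdvd (ha.trans hb.le)
    have := hdvd (ha.trans (hb.trans hc).le)
    omega
  have h3even : (n.choose 3 : ZMod 2) = 0 := by
    have := (ZMod.natCast_eq_natCast_iff _ _ _).2
      (Choose.choose_modEq_choose_mod_mul_choose_div_nat (p := 2) (n := n) (k := 3))
    rw [this, hn2]
    simp
  have h3p : 1 < 3 % p := by
    rw [Nat.mod_eq_of_lt (by omega)]
    omega
  set U : Finset ℕ := {3} ∆ ({2 ^ a} ∆ ({2 ^ b} ∆ {2 ^ c})) with hU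
  have hSU (S : Finset ℕ) : S ∆ U = S ∆ {3} ∆ {2 ^ a} ∆ {2 ^ b} ∆ {2 ^ c} := by
    simp only [hU, symmDiff_assoc]
  have hsub {S : Finset ℕ} (hS : S ⊆ Finset.Ico 1 n) : S ∆ U ⊆ Finset.Ico 1 n := by
    rw [hSU]
    iterate 4 refine symmDiff_singleton_subset ?_ (Finset.mem_Ico.2 (by omega))
    exact hS
  have hmod2 {S : Finset ℕ} (hS : S ⊆ Finset.Ico 1 n) :
      (beta n (S ∆ U) : ZMod 2) = (beta n S + p : ℕ) := by
    rw [hSU, beta_symmDiff_two_pows hab hbc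
      (symmDiff_singleton_subset hS (Finset.mem_Ico.2 (by omega))), ← hn,
      beta_symmDiff_of_choose_eq_zero (by omega) S h3even, CharTwo.neg_eq]
    have hpodd : (p : ZMod 2) = 1 :=
      (ZMod.natCast_eq_one_iff_odd).2 (hp.odd_of_ne_two (by omega))
    push_cast [hpodd]
    rfl
  have hmodp (S : Finset ℕ) : (beta n (S ∆ U) : ZMod p) = (beta n S + p : ℕ) := by
    rw [hSU, beta_symmDiff_of_choose_eq_zero (by omega) _
        (choose_eq_zero_of_mod_eq_one hp hn1 (hpow hc0)),
      beta_symmDiff_of_choose_eq_zero (by omega) _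
        (choose_eq_zero_of_mod_eq_one hp hn1 (hpow hb0)),
      beta_symmDiff_of_choose_eq_zero (by omega) _
        (choose_eq_zero_of_mod_eq_one hp hn1 (hpow ha0)),
      beta_symmDiff_of_choose_eq_zero (by omega) _
        (choose_eq_zero_of_mod_eq_one hp hn1 h3p)]
    simp
  refine cyclotomic_two_mul_dvd_Q hp.pos U (fun S hS => hsub hS) fun S hS => ?_
  exact (Nat.modEq_and_modEq_iff_modEq_mul
    ((Nat.coprime_primes Nat.prime_two hp).2 (by omega))).1
    ⟨(ZMod.natCast_eq_natCast_iff _ _ _).1 (hmod2 hS),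
      (ZMod.natCast_eq_natCast_iff _ _ _).1 (hmodp S)⟩
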